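/- arXiv:2602.21210 — 2 statements merged into one kernel-verified Lean document; each statement's English description precedes it below -/
import Mathlib

section
/- There are no simple anti-Leibniz algebras over ℂ: if A is an anti-Leibniz algebra over ℂ whose only two-sided ideals are {0} and A itself, then the multiplication of A is identically zero (x*y = 0 for all x, y ∈ A). -/
/-- A two-sided ideal of a (non-associative) ℂ-algebra given by a bilinear
multiplication: a ℂ-subspace closed under left and right multiplication by
arbitrary elements. -/
def IsTwoSidedIdeal {A : Type*} [AddCommGroup A] [Module ℂ A]
    (mul : A →ₗ[ℂ] A →ₗ[ℂ] A) (I : Submodule ℂ A) : Prop :=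
  ∀ a i : A, i ∈ I → mul a i ∈ I ∧ mul i a ∈ I

/-! Strict lexicographic comparison of words (the prefix case is excluded). -/

namespace AntiLeib

def SL : List ℕ → List ℕ → Prop
  | i :: x, j :: y => i < j ∨ (i = j ∧ SL x y)
  | [], _ => False
  | _ :: _, [] => False

@[simp] theorem SL_cons (i j : ℕ) (x y : List ℕ) :
    SL (i :: x) (j :: y) ↔ i < j ∨ (i = j ∧ SL x y) := by simp [SL]

@[simp] theorem SL_nil_left (y : List ℕ) : ¬ SL [] y := by simp [SL]

@[simp] theorem SL_nil_right (y : List ℕ) : ¬ SL y [] := by cases y <;> simp [SL]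

theorem SL_left (z : List ℕ) {x y : List ℕ} (h : SL x y) : SL (z ++ x) (z ++ y) := by
  induction z with
  | nil => simpa
  | cons i z ih => simp [ih]

theorem SL_right {x y : List ℕ} (s t : List ℕ) (h : SL x y) : SL (x ++ s) (y ++ t) := by
  induction x generalizing y with
  | nil => simp at h
  | cons i x ih =>
    cases y with
    | nil => simp at h
    | cons j y =>
      simp only [SL_cons, List.cons_append] at h ⊢
      rcases h with h | ⟨h, h'⟩
      · exact Or.inl h
      · exact Or.inr ⟨h, ih h'⟩

theorem SL_irrefl (x : List ℕ) : ¬ SL x x := by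
  induction x with
  | nil => simp
  | cons i x ih => simp [ih]

theorem SL_trans {x y z : List ℕ} (h : SL x y) (h' : SL y z) : SL x z := by
  induction x generalizing y z with
  | nil => simp at h
  | cons i x ih =>
    cases y with
    | nil => simp at h
    | cons j y =>
      cases z with
      | nil => simp at h'
      | cons k z =>
        simp only [SL_cons] at h h' ⊢
        rcases h with h | ⟨h, h1⟩ <;> rcases h' with h' | ⟨h', h2⟩
        · left; omega
        · left; omega
        · left; omega
        · right; exact ⟨by omega, ih h1 h2⟩

theorem SL_tri (a : ℕ) (v w : List ℕ) (hv : ∀ i ∈ v, i < a) (hw : ∀ i ∈ w, i < a) :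
    SL (v ++ [a]) (w ++ [a]) ∨ v = w ∨ SL (w ++ [a]) (v ++ [a]) := by
  induction v generalizing w with
  | nil =>
    cases w with
    | nil => simp
    | cons j w => simp at hw ⊢; omega
  | cons i v ih =>
    cases w with
    | nil => simp at hv ⊢; omega
    | cons j w =>
      simp only [List.mem_cons, forall_eq_or_imp] at hv hw
      have := ih w hv.2 hw.2
      simp only [List.cons_append, SL_cons, List.cons.injEq]
      rcases lt_trichotomy i j with h | h | h
      · omega
      · subst h; simp; exact this
      · omega

theorem SL_between (p s t x : List ℕ) (h1 : SL (p ++ s) x) (h2 : SL x (p ++ t)) :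
    p <+: x := by
  induction p generalizing x with
  | nil => simp
  | cons i p ih =>
    cases x with
    | nil => simp at h1
    | cons j x =>
      simp only [List.cons_append, SL_cons] at h1 h2
      have hij : i = j := by omega
      subst hij
      simp only [lt_irrefl, true_and, false_or] at h1 h2
      rw [List.cons_prefix_cons]
      exact ⟨rfl, ih x h1 h2⟩

section Alg

variable {E : Type*} [Ring E] [Algebra ℂ E]

def rho (a : ℕ → E) (w : List ℕ) : E := (w.map a).prod

theorem rho_append (a : ℕ → E) (u v : List ℕ) : rho a (u ++ v) = rho a u * rho a v := by
  simp [rho]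

/-- Span of the lexicographically smaller rearrangements of a word. -/
def Sp (a : ℕ → E) (u : List ℕ) : Submodule ℂ E :=
  Submodule.span ℂ {f | ∃ u', u'.Perm u ∧ SL u' u ∧ f = rho a u'}

def LT (a : ℕ → E) (f : E) (u : List ℕ) : Prop := f - rho a u ∈ Sp a u

def Red (a : ℕ → E) (u : List ℕ) : Prop := rho a u ∈ Sp a u

theorem rho_mem {a : ℕ → E} {u v : List ℕ} (hp : v.Perm u) (h : SL v u) : rho a v ∈ Sp a u :=
  Submodule.subset_span ⟨v, hp, h, rfl⟩

theorem Sp_mono {a : ℕ → E} {u v : List ℕ} (hp : v.Perm u) (h : SL v u) : Sp a v ≤ Sp a u := by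
  refine Submodule.span_le.2 ?_
  rintro f ⟨u', h1, h2, rfl⟩
  exact rho_mem (h1.trans hp) (SL_trans h2 h)

theorem LT_mem {a : ℕ → E} {f : E} {u v : List ℕ} (hf : LT a f v) (hp : v.Perm u)
    (h : SL v u) : f ∈ Sp a u := by
  have h1 := (Sp a u).add_mem (Sp_mono hp h hf) (rho_mem hp h)
  simpa using h1

theorem Sp_mul_left {a : ℕ → E} {f : E} (x : List ℕ) {u : List ℕ} (hf : f ∈ Sp a u) :
    rho a x * f ∈ Sp a (x ++ u) := by
  induction hf using Submodule.span_induction with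
  | mem f hf =>
    obtain ⟨u', h1, h2, rfl⟩ := hf
    rw [← rho_append]
    exact rho_mem (h1.append_left x) (SL_left x h2)
  | zero => simp
  | add f g _ _ h1 h2 => rw [mul_add]; exact Submodule.add_mem _ h1 h2
  | smul c f _ h => rw [mul_smul_comm]; exact Submodule.smul_mem _ c h

theorem Sp_mul_right {a : ℕ → E} {f : E} {u : List ℕ} (x : List ℕ) (hf : f ∈ Sp a u) :
    f * rho a x ∈ Sp a (u ++ x) := by
  induction hf using Submodule.span_induction with
  | mem f hf =>
    obtain ⟨u', h1, h2, rfl⟩ := hf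
    rw [← rho_append]
    exact rho_mem (h1.append_right x) (SL_right x x h2)
  | zero => simp
  | add f g _ _ h1 h2 => rw [add_mul]; exact Submodule.add_mem _ h1 h2
  | smul c f _ h => rw [smul_mul_assoc]; exact Submodule.smul_mem _ c h

theorem Sp_mul {a : ℕ → E} {f g : E} {u v : List ℕ} (hf : f ∈ Sp a u) (hg : g ∈ Sp a v) :
    f * g ∈ Sp a (u ++ v) := by
  induction hf using Submodule.span_induction with
  | mem f hf =>
    obtain ⟨u', h1, h2, rfl⟩ := hf
    exact Sp_mono (h1.append_right v) (SL_right v v h2) (Sp_mul_left u' hg)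
  | zero => simp
  | add f g _ _ h1 h2 => rw [add_mul]; exact Submodule.add_mem _ h1 h2
  | smul c f _ h => rw [smul_mul_assoc]; exact Submodule.smul_mem _ c h

theorem LT_mul {a : ℕ → E} {f g : E} {u v : List ℕ} (hf : LT a f u) (hg : LT a g v) :
    LT a (f * g) (u ++ v) := by
  unfold LT at *
  have h1 := Sp_mul hf hg
  have h2 := Sp_mul_left u hg
  have h3 := Sp_mul_right v hf
  have : f * g - rho a (u ++ v) = (f - rho a u) * (g - rho a v) + rho a u * (g - rho a v)
      + (f - rho a u) * rho a v := by
    rw [rho_append]; noncomm_ring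
  rw [this]
  exact add_mem (add_mem h1 h2) h3

theorem Red_of_LT_zero {a : ℕ → E} {u : List ℕ} (h : LT a 0 u) : Red a u := by
  unfold LT at h
  simpa [Red] using h

theorem Red_infix {a : ℕ → E} {u w : List ℕ} (h : Red a u) (hi : u <:+: w) : Red a w := by
  obtain ⟨x, y, rfl⟩ := hi
  unfold Red
  rw [rho_append, rho_append]
  exact Sp_mul_right y (Sp_mul_left x h)

/-- Abstract properties of the set of operators attached to square-zero elements. -/
structure Good (Z : Set E) : Prop where
  sq : ∀ g ∈ Z, g * g = 0
  sand : ∀ g ∈ Z, ∀ h ∈ Z, g * h * g = 0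
  clo : ∀ g ∈ Z, ∀ h ∈ Z, g * h + h * g ∈ Z
  perm : ∀ x ∈ Z, ∀ y ∈ Z, ∀ z ∈ Z,
    x * y * z + x * z * y + y * x * z + y * z * x + z * x * y + z * y * x = 0

def Lead (a : ℕ → E) (Z : Set E) (u : List ℕ) : Prop := ∃ g ∈ Z, LT a g u

variable {a : ℕ → E} {Z : Set E}

theorem Lead_letter (ha : ∀ i, a i ∈ Z) (i : ℕ) : Lead a Z [i] :=
  ⟨a i, ha i, by simp [LT, rho]⟩

theorem Lead_mul (hZ : Good Z) {u v : List ℕ} (hu : Lead a Z u) (hv : Lead a Z v)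
    (h : SL (v ++ u) (u ++ v)) : Lead a Z (u ++ v) := by
  obtain ⟨g, hg, hgu⟩ := hu
  obtain ⟨k, hk, hkv⟩ := hv
  refine ⟨g * k + k * g, hZ.clo g hg k hk, ?_⟩
  have h1 := LT_mul hgu hkv
  have h2 := LT_mem (LT_mul hkv hgu) List.perm_append_comm h
  unfold LT at *
  have := add_mem h1 h2
  convert this using 1
  abel

theorem Lead_block (hZ : Good Z) (ha : ∀ i, a i ∈ Z) (n : ℕ) (v : List ℕ)
    (hv : ∀ i ∈ v, i < n) : Lead a Z (n :: v) := by
  induction v using List.reverseRecOn with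
  | nil => exact Lead_letter ha n
  | append_singleton v i ih =>
    have h1 := ih (fun j hj => hv j (by simp [hj]))
    have hi := hv i (by simp)
    have := Lead_mul hZ h1 (Lead_letter ha i) (by simp [hi])
    simpa using this

theorem Red_sq (hZ : Good Z) {u : List ℕ} (hu : Lead a Z u) : Red a (u ++ u) := by
  obtain ⟨g, hg, hgu⟩ := hu
  have := LT_mul hgu hgu
  rw [hZ.sq g hg] at this
  exact Red_of_LT_zero this

theorem Red_sand (hZ : Good Z) {u v : List ℕ} (hu : Lead a Z u) (hv : Lead a Z v) :
    Red a (u ++ v ++ u) := by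
  obtain ⟨g, hg, hgu⟩ := hu
  obtain ⟨k, hk, hkv⟩ := hv
  have := LT_mul (LT_mul hgu hkv) hgu
  rw [hZ.sand g hg k hk] at this
  exact Red_of_LT_zero this

theorem Red_perm (hZ : Good Z) {x y z : List ℕ} (hx : Lead a Z x) (hy : Lead a Z y)
    (hz : Lead a Z z)
    (h1 : SL (x ++ z ++ y) (x ++ y ++ z)) (h2 : SL (y ++ x ++ z) (x ++ y ++ z))
    (h3 : SL (y ++ z ++ x) (x ++ y ++ z)) (h4 : SL (z ++ x ++ y) (x ++ y ++ z))
    (h5 : SL (z ++ y ++ x) (x ++ y ++ z)) : Red a (x ++ y ++ z) := by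
  obtain ⟨f, hf, hfx⟩ := hx
  obtain ⟨g, hg, hgy⟩ := hy
  obtain ⟨k, hk, hkz⟩ := hz
  have e0 := LT_mul (LT_mul hfx hgy) hkz
  have e1 := LT_mem (LT_mul (LT_mul hfx hkz) hgy)
    (by rw [List.perm_iff_count]; intro t; simp only [List.count_append]; omega) h1
  have e2 := LT_mem (LT_mul (LT_mul hgy hfx) hkz)
    (by rw [List.perm_iff_count]; intro t; simp only [List.count_append]; omega) h2
  have e3 := LT_mem (LT_mul (LT_mul hgy hkz) hfx)
    (by rw [List.perm_iff_count]; intro t; simp only [List.count_append]; omega) h3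
  have e4 := LT_mem (LT_mul (LT_mul hkz hfx) hgy)
    (by rw [List.perm_iff_count]; intro t; simp only [List.count_append]; omega) h4
  have e5 := LT_mem (LT_mul (LT_mul hkz hgy) hfx)
    (by rw [List.perm_iff_count]; intro t; simp only [List.count_append]; omega) h5
  have hs := hZ.perm f hf g hg k hk
  unfold LT at e0
  have e6 := (Submodule.neg_mem_iff _).2
    (add_mem (add_mem (add_mem (add_mem (add_mem e0 e1) e2) e3) e4) e5)
  unfold Red
  convert e6 using 1
  have : rho a (x ++ y ++ z) = rho a (x ++ y ++ z) - (f * g * k + f * k * g + g * f * k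
    + g * k * f + k * f * g + k * g * f) := by rw [hs]; simp
  rw [this]
  simp only [hs, sub_zero]
  have h0 : f * g * k = -(f * k * g + g * f * k + g * k * f + k * f * g + k * g * f) := by
    rw [eq_neg_iff_add_eq_zero, ← hs]; abel
  rw [h0]; abel

/-- The key combinatorial lemma on three consecutive blocks. -/
theorem key (hZ : Good Z) (ha : ∀ i, a i ∈ Z) (n : ℕ) (v v' v'' : List ℕ)
    (hv : ∀ i ∈ v, i < n) (hv' : ∀ i ∈ v', i < n) (hv'' : ∀ i ∈ v'', i < n)
    (hr : ¬ Red a ((n :: v) ++ (n :: v') ++ (n :: v''))) :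
    SL (v ++ [n]) (v' ++ [n]) ∨ SL (v ++ [n]) (v'' ++ [n]) := by
  by_contra hcon
  push Not at hcon
  obtain ⟨hc1, hc2⟩ := hcon
  apply hr
  have L := Lead_block hZ ha n v hv
  have L' := Lead_block hZ ha n v' hv'
  have L'' := Lead_block hZ ha n v'' hv''
  rcases SL_tri n v v' hv hv' with h | h | hd
  · exact absurd h hc1
  · subst h
    exact Red_infix (Red_sq hZ L) ⟨[], n :: v'', by simp⟩
  rcases SL_tri n v' v'' hv' hv'' with h | h | hd'
  rotate_left
  · subst h
    exact Red_infix (Red_sq hZ L') ⟨n :: v, [], by simp⟩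
  · have hdd := SL_trans hd' hd
    apply Red_perm hZ L L' L''
    · have := SL_left (n :: (v ++ [n])) (SL_right v' v'' hd')
      simpa using this
    · have := SL_left [n] (SL_right (v ++ n :: v'') (v' ++ n :: v'') hd)
      simpa using this
    · have := SL_left [n] (SL_right (v'' ++ n :: v) (v' ++ n :: v'') hd)
      simpa using this
    · have := SL_left [n] (SL_right (v ++ n :: v') (v' ++ n :: v'') hdd)
      simpa using this
    · have := SL_left [n] (SL_right (v' ++ n :: v) (v' ++ n :: v'') hdd)
      simpa using this
  -- now v' < v''
  rcases List.eq_nil_or_concat v' with h0 | ⟨p, s, h0⟩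
  · subst h0
    cases v with
    | nil => exact absurd hd (SL_irrefl _)
    | cons i v =>
      have := hv i (by simp)
      simp at hd
      omega
  rw [List.concat_eq_append] at h0
  subst h0
  have hp : ∀ i ∈ p, i < n := fun i hi => hv' i (by simp [hi])
  have hs : s < n := hv' s (by simp)
  have Lp := Lead_block hZ ha n p hp
  have Ls := Lead_letter ha (Z := Z) s
  rcases SL_tri n v p hv hp with hvp | hvp | hvp
  rotate_left
  · subst hvp
    exact Red_infix (Red_sq hZ Lp) ⟨[], s :: n :: v'', by simp⟩
  · have : Red a ((n :: v) ++ (n :: p) ++ [s]) := by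
      apply Red_perm hZ L Lp Ls
      · have : SL (s :: n :: p) (n :: (p ++ [s])) := by simp [hs]
        have := SL_left (n :: v) this
        simpa using this
      · have := SL_left [n] (SL_right (v ++ [s]) (p ++ [s]) hvp)
        simpa using this
      · have := SL_left [n] (SL_right v (p ++ [s]) hd)
        simpa using this
      · simp [hs]
      · simp [hs]
    exact Red_infix this ⟨[], n :: v'', by simp⟩
  have hx : SL (v'' ++ [n]) (p ++ [n]) := by
    rcases SL_tri n v v'' hv hv'' with h1 | h1 | h1
    · exact absurd h1 hc2
    · subst h1; exact hvp
    · exact SL_trans h1 hvp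
  have hpre := SL_between p ([s] ++ [n]) [n] (v'' ++ [n]) (by simpa using h) hx
  have hpre' : p <+: v'' := by
    rcases List.prefix_concat_iff.1 hpre with h1 | h1
    · have := hp n (by rw [h1]; simp)
      omega
    · exact h1
  obtain ⟨q, rfl⟩ := hpre'
  exact Red_infix (Red_sand hZ Lp Ls) ⟨n :: v, q, by simp⟩

def blocks (n : ℕ) (bs : List (List ℕ)) : List ℕ := (bs.map (fun v => n :: v)).flatten

theorem decomp (n : ℕ) (w : List ℕ) (hw : ∀ i ∈ w, i < n + 1) :
    ∃ w0 : List ℕ, ∃ bs : List (List ℕ), w = w0 ++ blocks n bs ∧ (∀ i ∈ w0, i < n) ∧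
      ∀ v ∈ bs, ∀ i ∈ v, i < n := by
  induction w with
  | nil => exact ⟨[], [], by simp [blocks]⟩
  | cons i w ih =>
    obtain ⟨w0, bs, h1, h2, h3⟩ := ih (fun j hj => hw j (by simp [hj]))
    have hi := hw i (by simp)
    by_cases h : i = n
    · refine ⟨[], w0 :: bs, ?_, by simp, ?_⟩
      · simp [blocks, h1, h]
      · intro v hv
        rcases List.mem_cons.1 hv with rfl | hv
        · exact h2
        · exact h3 v hv
    · refine ⟨i :: w0, bs, by simp [h1], ?_, h3⟩
      intro j hj
      rcases List.mem_cons.1 hj with rfl | hj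
      · omega
      · exact h2 j hj

theorem count_blocks (hZ : Good Z) (ha : ∀ i, a i ∈ Z) (n : ℕ) (F : Finset (List ℕ))
    (hF : ∀ v ∈ F, ∀ i ∈ v, i < n) (m : ℕ) :
    ∀ (v : List ℕ) (bs : List (List ℕ)), (∀ u ∈ v :: bs, u ∈ F) →
      ¬ Red a (blocks n (v :: bs)) →
      (∃ G : Finset (List ℕ), G.card ≤ m ∧ ∀ u ∈ F, SL (v ++ [n]) (u ++ [n]) → u ∈ G) →
      (v :: bs).length ≤ 2 * m + 2 := by
  induction m with
  | zero =>
    rintro v bs hb hr ⟨G, hG, hG'⟩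
    match bs with
    | [] => simp
    | [v'] => simp
    | v' :: v'' :: bs =>
      exfalso
      have hk := key hZ ha n v v' v'' (hF v (hb v (by simp))) (hF v' (hb v' (by simp)))
        (hF v'' (hb v'' (by simp))) (fun h => hr (Red_infix h ⟨[], blocks n bs, by simp [blocks]⟩))
      have hG0 : G = ∅ := Finset.card_eq_zero.1 (by omega)
      subst hG0
      rcases hk with hk | hk
      · exact absurd (hG' v' (hb v' (by simp)) hk) (by simp)
      · exact absurd (hG' v'' (hb v'' (by simp)) hk) (by simp)
  | succ m ih =>
    rintro v bs hb hr ⟨G, hG, hG'⟩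
    match bs with
    | [] => simp
    | [v'] => simp
    | v' :: v'' :: bs =>
      have hk := key hZ ha n v v' v'' (hF v (hb v (by simp))) (hF v' (hb v' (by simp)))
        (hF v'' (hb v'' (by simp))) (fun h => hr (Red_infix h ⟨[], blocks n bs, by simp [blocks]⟩))
      have step : ∀ u ∈ F, SL (v ++ [n]) (u ++ [n]) →
          ∃ G : Finset (List ℕ), G.card ≤ m ∧ ∀ t ∈ F, SL (u ++ [n]) (t ++ [n]) → t ∈ G := by
        intro u hu huv
        refine ⟨G.erase u, ?_, ?_⟩
        · rw [Finset.card_erase_of_mem (hG' u hu huv)]; omega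
        · intro t ht hut
          refine Finset.mem_erase.2 ⟨?_, hG' t ht (SL_trans huv hut)⟩
          rintro rfl
          exact SL_irrefl _ hut
      rcases hk with hk | hk
      · have := ih v' (v'' :: bs) (fun u hu => hb u (List.mem_cons_of_mem _ hu))
          (fun h => hr (Red_infix h ⟨n :: v, [], by simp [blocks]⟩))
          (step v' (hb v' (by simp)) hk)
        simp at this ⊢; omega
      · have := ih v'' bs (fun u hu => hb u (List.mem_cons_of_mem _ (List.mem_cons_of_mem _ hu)))
          (fun h => hr (Red_infix h ⟨n :: v ++ n :: v', [], by simp [blocks]⟩))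
          (step v'' (hb v'' (by simp)) hk)
        simp at this ⊢; omega

theorem finite_words (n N : ℕ) : {v : List ℕ | (∀ i ∈ v, i < n) ∧ v.length < N}.Finite := by
  have h := (List.finite_length_lt (Fin n) N).image (List.map Fin.val)
  refine h.subset ?_
  rintro v ⟨h1, h2⟩
  refine ⟨v.pmap (fun i hi => ⟨i, hi⟩) h1, by simpa using h2, ?_⟩
  simp [List.map_pmap]

theorem blocks_length (n N : ℕ) (bs : List (List ℕ)) (h : ∀ v ∈ bs, v.length < N) :
    (blocks n bs).length ≤ bs.length * N := by
  induction bs with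
  | nil => simp [blocks]
  | cons v bs ih =>
    have h1 := ih (fun u hu => h u (by simp [hu]))
    have h2 := h v (by simp)
    have : blocks n (v :: bs) = n :: v ++ blocks n bs := by simp [blocks]
    rw [this, List.length_append, List.length_cons, List.length_cons, Nat.succ_mul]
    omega

theorem infix_blocks (n : ℕ) (bs : List (List ℕ)) (v : List ℕ) (hv : v ∈ bs) :
    v <:+: blocks n bs := by
  obtain ⟨s, t, rfl⟩ := List.append_of_mem hv
  exact ⟨blocks n s ++ [n], blocks n t, by simp [blocks]⟩

theorem long_red (hZ : Good Z) (ha : ∀ i, a i ∈ Z) (n : ℕ) :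
    ∃ N : ℕ, ∀ w : List ℕ, (∀ i ∈ w, i < n) → N ≤ w.length → Red a w := by
  induction n with
  | zero =>
    refine ⟨1, fun w hw h => ?_⟩
    cases w with
    | nil => simp at h
    | cons i w => exact absurd (hw i (by simp)) (by omega)
  | succ n ih =>
    obtain ⟨N, hN⟩ := ih
    let F := (finite_words n N).toFinset
    refine ⟨N + (2 * F.card + 2) * N, fun w hw hl => ?_⟩
    by_contra hr
    obtain ⟨w0, bs, rfl, h2, h3⟩ := decomp n w hw
    have hw0 : w0.length < N := by
      by_contra h
      exact hr (Red_infix (hN w0 h2 (by omega)) ⟨[], blocks n bs, by simp⟩)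
    have hrb : ¬ Red a (blocks n bs) := fun h => hr (Red_infix h ⟨w0, [], by simp⟩)
    have hb : ∀ v ∈ bs, v.length < N := by
      intro v hv
      by_contra h
      exact hrb (Red_infix (hN v (h3 v hv) (by omega)) (infix_blocks n bs v hv))
    have hlen : bs.length ≤ 2 * F.card + 2 := by
      cases bs with
      | nil => simp
      | cons v bs =>
        refine count_blocks hZ ha n F ?_ F.card v bs ?_ hrb ⟨F, le_rfl, fun u hu _ => hu⟩
        · intro v hv
          have : v ∈ {v : List ℕ | (∀ i ∈ v, i < n) ∧ v.length < N} := by simpa [F] using hv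
          exact this.1
        · intro u hu
          have : u ∈ {v : List ℕ | (∀ i ∈ v, i < n) ∧ v.length < N} := ⟨h3 u hu, hb u hu⟩
          simpa [F] using this
    have h5 := blocks_length n N bs hb
    have h6 := Nat.mul_le_mul_right N hlen
    rw [List.length_append] at hl
    omega

theorem long_zero (hZ : Good Z) (ha : ∀ i, a i ∈ Z) (n : ℕ) :
    ∃ N : ℕ, ∀ w : List ℕ, (∀ i ∈ w, i < n) → N ≤ w.length → rho a w = 0 := by
  obtain ⟨N, hN⟩ := long_red hZ ha n
  refine ⟨N, fun w0 hw0 hl0 => ?_⟩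
  have hfin : {u : List ℕ | u.Perm w0}.Finite := by
    refine (w0.permutations.toFinset.finite_toSet).subset ?_
    intro u hu
    simpa using hu
  let T := {u : List ℕ // u.Perm w0}
  have : Finite T := hfin.to_subtype
  let r : T → T → Prop := fun x y => SL x.1 y.1
  have : IsTrans T r := ⟨fun x y z h h' => SL_trans h h'⟩
  have : Std.Irrefl r := ⟨fun x => SL_irrefl x.1⟩
  have wf : WellFounded r := Finite.wellFounded_of_trans_of_irrefl r
  have main : ∀ x : T, rho a x.1 = 0 := by
    intro x
    induction x using wf.induction with
    | _ x ih =>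
      have hR := hN x.1 (fun i hi => hw0 i (x.2.mem_iff.1 hi)) (by rw [x.2.length_eq]; exact hl0)
      have : Sp a x.1 ≤ ⊥ := by
        refine Submodule.span_le.2 ?_
        rintro f ⟨u', h1, h2, rfl⟩
        exact ih ⟨u', h1.trans x.2⟩ h2
      simpa using this hR
  exact main ⟨w0, List.Perm.refl _⟩

end Alg

section Final

variable {A : Type*} [AddCommGroup A] [Module ℂ A]

def op (mul : A →ₗ[ℂ] A →ₗ[ℂ] A) : A →ₗ[ℂ] Module.End ℂ A := mul

def Zc (mul : A →ₗ[ℂ] A →ₗ[ℂ] A) : Set A := {c | mul c c = 0}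

theorem op_mul (mul : A →ₗ[ℂ] A →ₗ[ℂ] A)
    (antiLeib : ∀ x y z : A, mul (mul x y) z = - mul (mul x z) y - mul x (mul y z))
    (comm : ∀ x y, mul x y = mul y x) (x y : A) :
    op mul (mul x y) = -(op mul x * op mul y + op mul y * op mul x) := by
  ext z
  have := antiLeib x y z
  rw [comm (mul x z) y] at this
  simp only [op, LinearMap.neg_apply, LinearMap.add_apply, Module.End.mul_apply]
  rw [this]; abel

theorem op_sq (mul : A →ₗ[ℂ] A →ₗ[ℂ] A)
    (antiLeib : ∀ x y z : A, mul (mul x y) z = - mul (mul x z) y - mul x (mul y z))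
    (comm : ∀ x y, mul x y = mul y x) (c : A) (hc : c ∈ Zc mul) :
    op mul c * op mul c = 0 := by
  have h := op_mul mul antiLeib comm c c
  have hc' : mul c c = 0 := hc
  rw [hc', map_zero, ← two_smul ℂ, eq_comm, neg_eq_zero] at h
  exact (smul_eq_zero.1 h).resolve_left two_ne_zero

theorem op_perm (mul : A →ₗ[ℂ] A →ₗ[ℂ] A)
    (antiLeib : ∀ x y z : A, mul (mul x y) z = - mul (mul x z) y - mul x (mul y z))
    (comm : ∀ x y, mul x y = mul y x) (x y z : A) :
    op mul x * op mul y * op mul z + op mul x * op mul z * op mul y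
      + op mul y * op mul x * op mul z + op mul y * op mul z * op mul x
      + op mul z * op mul x * op mul y + op mul z * op mul y * op mul x = 0 := by
  have h := congrArg (op mul) (antiLeib x y z)
  simp only [map_sub, map_neg, op_mul mul antiLeib comm] at h
  rw [← sub_eq_zero] at h
  have h2 : (2 : ℂ) • (op mul x * op mul y * op mul z + op mul x * op mul z * op mul y
      + op mul y * op mul x * op mul z + op mul y * op mul z * op mul x
      + op mul z * op mul x * op mul y + op mul z * op mul y * op mul x) = 0 := by
    rw [← h, two_smul]
    noncomm_ring
  exact (smul_eq_zero.1 h2).resolve_left two_ne_zero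

theorem op_sand (mul : A →ₗ[ℂ] A →ₗ[ℂ] A)
    (antiLeib : ∀ x y z : A, mul (mul x y) z = - mul (mul x z) y - mul x (mul y z))
    (comm : ∀ x y, mul x y = mul y x) (c : A) (hc : c ∈ Zc mul) (d : A) :
    op mul c * op mul d * op mul c = 0 := by
  have h := op_perm mul antiLeib comm c c d
  have hs := op_sq mul antiLeib comm c hc
  have hs' : op mul d * op mul c * op mul c = 0 := by rw [mul_assoc, hs, mul_zero]
  rw [hs, hs'] at h
  have h2 : (2 : ℂ) • (op mul c * op mul d * op mul c) = 0 := by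
    rw [← h, two_smul]
    simp
  exact (smul_eq_zero.1 h2).resolve_left two_ne_zero

theorem op_good (mul : A →ₗ[ℂ] A →ₗ[ℂ] A)
    (antiLeib : ∀ x y z : A, mul (mul x y) z = - mul (mul x z) y - mul x (mul y z))
    (comm : ∀ x y, mul x y = mul y x) : Good (op mul '' Zc mul) where
  sq := by
    rintro _ ⟨c, hc, rfl⟩
    exact op_sq mul antiLeib comm c hc
  sand := by
    rintro _ ⟨c, hc, rfl⟩ _ ⟨d, _, rfl⟩
    exact op_sand mul antiLeib comm c hc d
  clo := by
    rintro _ ⟨c, hc, rfl⟩ _ ⟨d, _, rfl⟩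
    refine ⟨-(mul c d), ?_, ?_⟩
    · have h1 : mul c (mul c d) = 0 :=
        LinearMap.congr_fun (op_sq mul antiLeib comm c hc) d
      have h2 : mul c (mul d (mul c d)) = 0 :=
        LinearMap.congr_fun (op_sand mul antiLeib comm c hc d) d
      have h3 := antiLeib c d (mul c d)
      rw [h1, h2] at h3
      simp only [Zc, Set.mem_setOf_eq, map_neg, LinearMap.neg_apply, neg_neg]
      rw [h3]; simp
    · rw [map_neg, op_mul mul antiLeib comm, neg_neg]
  perm := by
    rintro _ ⟨x, _, rfl⟩ _ ⟨y, _, rfl⟩ _ ⟨z, _, rfl⟩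
    exact op_perm mul antiLeib comm x y z

/-- Products of at least `k` operators coming from `s`. -/
def W (mul : A →ₗ[ℂ] A →ₗ[ℂ] A) (s : Set A) (k : ℕ) : Submodule ℂ (Module.End ℂ A) :=
  Submodule.span ℂ {f | ∃ l : List A, k ≤ l.length ∧ (∀ x ∈ l, x ∈ s) ∧
    f = (l.map (op mul)).prod}

theorem W_mono (mul : A →ₗ[ℂ] A →ₗ[ℂ] A) {s t : Set A} (h : s ⊆ t) (k : ℕ) :
    W mul s k ≤ W mul t k := by
  refine Submodule.span_mono ?_
  rintro f ⟨l, h1, h2, h3⟩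
  exact ⟨l, h1, fun x hx => h (h2 x hx), h3⟩

theorem W_mul (mul : A →ₗ[ℂ] A →ₗ[ℂ] A) {s : Set A} {j k : ℕ} {f g : Module.End ℂ A}
    (hf : f ∈ W mul s j) (hg : g ∈ W mul s k) : f * g ∈ W mul s (j + k) := by
  have h := Submodule.mul_mem_mul hf hg
  unfold W at h
  rw [Submodule.span_mul_span] at h
  refine Submodule.span_mono ?_ h
  rintro _ ⟨_, ⟨l, h1, h2, rfl⟩, _, ⟨l', h1', h2', rfl⟩, rfl⟩
  refine ⟨l ++ l', by simp; omega, ?_, by simp⟩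
  intro x hx
  rcases List.mem_append.1 hx with h | h
  · exact h2 x h
  · exact h2' x h

theorem W_zero (mul : A →ₗ[ℂ] A →ₗ[ℂ] A)
    (antiLeib : ∀ x y z : A, mul (mul x y) z = - mul (mul x z) y - mul x (mul y z))
    (comm : ∀ x y, mul x y = mul y x) (s : Finset A) (hs : (s : Set A) ⊆ Zc mul) :
    ∃ N, W mul (s : Set A) N = ⊥ := by
  classical
  let c : ℕ → A := fun i => s.toList.getD i 0
  have hc : ∀ i, c i ∈ Zc mul := by
    intro i
    by_cases h : i < s.toList.length
    · have : c i = s.toList[i] := List.getD_eq_getElem _ _ h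
      rw [this]
      exact hs (Finset.mem_coe.2 (Finset.mem_toList.1 (List.getElem_mem h)))
    · have : c i = 0 := List.getD_eq_default _ _ (by omega)
      rw [this]; simp [Zc]
  obtain ⟨N, hN⟩ := long_zero (a := fun i => op mul (c i)) (op_good mul antiLeib comm)
    (fun i => ⟨c i, hc i, rfl⟩) s.toList.length
  refine ⟨N, ?_⟩
  rw [eq_bot_iff]
  refine Submodule.span_le.2 ?_
  rintro _ ⟨l, h1, h2, rfl⟩
  have h3 := hN (l.map (fun x => s.toList.idxOf x)) (by
    intro i hi
    obtain ⟨x, hx, rfl⟩ := List.mem_map.1 hi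
    exact List.idxOf_lt_length_iff.2 (by simpa using h2 x hx)) (by simpa using h1)
  have h4 : l.map (op mul) = (l.map (fun x => s.toList.idxOf x)).map (fun i => op mul (c i)) := by
    rw [List.map_map]
    refine List.map_congr_left fun x hx => ?_
    have hx' : x ∈ s.toList := by simpa using h2 x hx
    have hlt := List.idxOf_lt_length_iff.2 hx'
    have : c (s.toList.idxOf x) = x := by
      have h5 : c (s.toList.idxOf x) = s.toList[s.toList.idxOf x] :=
        List.getD_eq_getElem _ _ hlt
      rw [h5]; simp
    simp [this]
  unfold rho at h3
  rw [h4, h3]; simp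

theorem comm_case (mul : A →ₗ[ℂ] A →ₗ[ℂ] A)
    (antiLeib : ∀ x y z : A, mul (mul x y) z = - mul (mul x z) y - mul x (mul y z))
    (comm : ∀ x y, mul x y = mul y x)
    (hsimple : ∀ I : Submodule ℂ A, IsTwoSidedIdeal mul I → I = ⊥ ∨ I = ⊤) :
    ∀ x y : A, mul x y = 0 := by
  classical
  intro x y
  by_contra hxy
  -- squares span
  have hsp : Submodule.span ℂ (Zc mul) = ⊤ := by
    have hsq : ∀ u : A, mul u u ∈ Zc mul := by
      intro u
      have h0 := antiLeib u u u
      have h1 : mul (mul u u) u = 0 := by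
        rw [comm u (mul u u)] at h0
        have h2 : (3 : ℂ) • mul (mul u u) u = 0 := by
          have e : (3 : ℂ) • mul (mul u u) u
            = mul (mul u u) u + mul (mul u u) u + mul (mul u u) u := by module
          rw [e]; nth_rewrite 1 [h0]; abel
        exact (smul_eq_zero.1 h2).resolve_left three_ne_zero
      have h3 := antiLeib u u (mul u u)
      rw [comm u (mul u u), h1] at h3
      simpa [Zc] using h3
    have hprod : ∀ u v : A, mul u v ∈ Submodule.span ℂ (Zc mul) := by
      intro u v
      have h1 := Submodule.subset_span (R := ℂ) (hsq (u + v))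
      have h2 := Submodule.subset_span (R := ℂ) (hsq u)
      have h3 := Submodule.subset_span (R := ℂ) (hsq v)
      have h4 := Submodule.smul_mem _ (2⁻¹ : ℂ) (sub_mem (sub_mem h1 h2) h3)
      convert h4 using 1
      simp only [map_add, LinearMap.add_apply]
      rw [comm v u]
      module
    rcases hsimple (Submodule.span ℂ (Zc mul)) (fun u i _ => ⟨hprod _ _, hprod _ _⟩) with h | h
    · exact absurd (by simpa [h] using hprod x y) hxy
    · exact h
  have hop : ∀ u : A, ∃ t : Finset A, (t : Set A) ⊆ Zc mul ∧ op mul u ∈ W mul (t : Set A) 1 := by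
    intro u
    have hu : u ∈ Submodule.span ℂ (Zc mul) := by rw [hsp]; trivial
    obtain ⟨t, ht, hut⟩ := Submodule.mem_span_finite_of_mem_span hu
    refine ⟨t, ht, ?_⟩
    have : Submodule.span ℂ (t : Set A) ≤ (W mul (t : Set A) 1).comap (op mul) := by
      refine Submodule.span_le.2 ?_
      intro z hz
      exact Submodule.subset_span ⟨[z], by simp, by simpa using hz, by simp⟩
    exact this hut
  let I : Submodule ℂ A :=
    { carrier := {z | ∃ t : Finset A, (t : Set A) ⊆ Zc mul ∧ ∃ g ∈ W mul (t : Set A) 1, g x = z}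
      zero_mem' := ⟨∅, by simp, 0, Submodule.zero_mem _, by simp⟩
      add_mem' := by
        rintro _ _ ⟨t, ht, g, hg, rfl⟩ ⟨t', ht', g', hg', rfl⟩
        refine ⟨t ∪ t', by simp [ht, ht'], g + g', add_mem (W_mono mul ?_ 1 hg)
          (W_mono mul ?_ 1 hg'), by simp⟩ <;> simp
      smul_mem' := by
        rintro k _ ⟨t, ht, g, hg, rfl⟩
        exact ⟨t, ht, k • g, Submodule.smul_mem _ k hg, by simp⟩ }
  have hI : IsTwoSidedIdeal mul I := by
    intro u z hz
    have key : mul u z ∈ I := by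
      obtain ⟨t, ht, g, hg, rfl⟩ := hz
      obtain ⟨t', ht', hu⟩ := hop u
      refine ⟨t ∪ t', by simp [ht, ht'], op mul u * g, ?_, rfl⟩
      have h1 : op mul u ∈ W mul ((t ∪ t' : Finset A) : Set A) 1 := W_mono mul (by simp) 1 hu
      have h2 : g ∈ W mul ((t ∪ t' : Finset A) : Set A) 1 := W_mono mul (by simp) 1 hg
      refine (Submodule.span_mono ?_ : W mul _ (1 + 1) ≤ W mul _ 1) (W_mul mul h1 h2)
      rintro f ⟨l, h1, h2⟩
      exact ⟨l, by omega, h2⟩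
    exact ⟨key, by rw [comm]; exact key⟩
  have hyI : mul y x ∈ I := by
    obtain ⟨t, ht, hu⟩ := hop y
    exact ⟨t, ht, op mul y, hu, rfl⟩
  rcases hsimple I hI with h | h
  · rw [h, Submodule.mem_bot, comm] at hyI
    exact hxy hyI
  · have hx : x ∈ I := by rw [h]; trivial
    obtain ⟨t, ht, g, hg, hgx⟩ := hx
    obtain ⟨N, hN⟩ := W_zero mul antiLeib comm t ht
    have hpow : ∀ k, g ^ k ∈ W mul (t : Set A) k := by
      intro k
      induction k with
      | zero => exact Submodule.subset_span ⟨[], by simp, by simp, by simp⟩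
      | succ k ih => rw [pow_succ]; exact W_mul mul ih hg
    have hfix : ∀ k, (g ^ k) x = x := by
      intro k
      induction k with
      | zero => simp
      | succ k ih => rw [pow_succ, Module.End.mul_apply, hgx, ih]
    have h0 := hpow N
    rw [hN, Submodule.mem_bot] at h0
    have h1 := hfix N
    rw [h0] at h1
    apply hxy
    rw [← h1]; simp

end Final

end AntiLeib

/-- There are no simple anti-Leibniz algebras over ℂ: if the only
two-sided ideals of an anti-Leibniz algebra are {0} and A, then the
multiplication is identically zero. -/
theorem no_simple_antiLeibniz
    (A : Type*) [AddCommGroup A] [Module ℂ A]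
    (mul : A →ₗ[ℂ] A →ₗ[ℂ] A)
    (antiLeib : ∀ x y z : A,
      mul (mul x y) z = - mul (mul x z) y - mul x (mul y z))
    (hsimple : ∀ I : Submodule ℂ A, IsTwoSidedIdeal mul I → I = ⊥ ∨ I = ⊤) :
    ∀ x y : A, mul x y = 0 := by
  have hsymm : ∀ x y z, mul x (mul y z) = mul x (mul z y) := by
    intro x y z
    have h1 := antiLeib x y z
    have h2 := antiLeib x z y
    have e1 : mul x (mul y z) = - mul (mul x z) y - mul (mul x y) z := by rw [h1]; abel
    have e2 : mul x (mul z y) = - mul (mul x y) z - mul (mul x z) y := by rw [h2]; abel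
    rw [e1, e2]; abel
  let N : Submodule ℂ A :=
    { carrier := {u | ∀ x, mul x u = 0}
      zero_mem' := by simp
      add_mem' := by
        intro u v hu hv x
        rw [map_add, hu x, hv x, add_zero]
      smul_mem' := by
        intro k u hu x
        rw [map_smul, hu x, smul_zero] }
  have hN : IsTwoSidedIdeal mul N := by
    intro u i hi
    have hi' : ∀ x, mul x i = 0 := hi
    refine ⟨?_, ?_⟩
    · rw [hi' u]; exact N.zero_mem
    · intro x
      rw [hsymm, hi' u, map_zero]
  rcases hsimple N hN with h | h
  · refine AntiLeib.comm_case mul antiLeib ?_ hsimple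
    intro x y
    have : mul x y - mul y x ∈ N := by
      intro z
      rw [map_sub, hsymm z x y, sub_self]
    rw [h, Submodule.mem_bot] at this
    exact sub_eq_zero.1 this
  · intro x y
    have : y ∈ N := by rw [h]; trivial
    exact this x
end

section
/- Every finite-dimensional anti-Zinbiel algebra Z over ℂ is nilpotent: there exists N ∈ ℕ such that Z^N = {0}, where Z^1 = Z and, for n ≥ 2, Z^n = Σ_{i+j=n, i,j≥1} span{x*y : x ∈ Z^i, y ∈ Z^j}. -/
/-- The lower central (power) series of a (non-associative) ℂ-algebra:
Z^1 = Z and, for n ≥ 2, Z^n = Σ_{i+j=n, i,j ≥ 1} span{x*y : x ∈ Z^i, y ∈ Z^j}.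
(The unused value Z^0 is set to {0} by convention.) -/
def algPowerSeries {Z : Type*} [AddCommGroup Z] [Module ℂ Z]
    (mul : Z →ₗ[ℂ] Z →ₗ[ℂ] Z) : ℕ → Submodule ℂ Z
  | 0 => ⊥
  | 1 => ⊤
  | n + 2 =>
    ⨆ i : Fin (n + 1), Submodule.span ℂ
      {z : Z | ∃ x ∈ algPowerSeries mul (i + 1),
          ∃ y ∈ algPowerSeries mul (n + 1 - i), z = mul x y}
  decreasing_by
  · omega
  · omega

/-- Right-nested powers, shifted by one: `rightPow mul n` plays the role of `Z^(n+1)`. -/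
def rightPow {Z : Type*} [AddCommGroup Z] [Module ℂ Z]
    (mul : Z →ₗ[ℂ] Z →ₗ[ℂ] Z) : ℕ → Submodule ℂ Z
  | 0 => ⊤
  | n + 1 => Submodule.map₂ mul ⊤ (rightPow mul n)

/-- Elements killed by any `n` left multiplications. -/
def leftAnn {Z : Type*} [AddCommGroup Z] [Module ℂ Z]
    (mul : Z →ₗ[ℂ] Z →ₗ[ℂ] Z) : ℕ → Submodule ℂ Z
  | 0 => ⊥
  | n + 1 => ⨅ x : Z, (leftAnn mul n).comap (mul x)

section
variable {Z : Type*} [AddCommGroup Z] [Module ℂ Z] (mul : Z →ₗ[ℂ] Z →ₗ[ℂ] Z)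

theorem rightPow_le_leftAnn (n k : ℕ) (h : rightPow mul n ≤ leftAnn mul (k + 1)) :
    rightPow mul (n + 1) ≤ leftAnn mul k := by
  rw [rightPow, Submodule.map₂_le]
  intro x _ w hw
  have := h hw
  simp only [leftAnn, Submodule.mem_iInf, Submodule.mem_comap] at this
  exact this x

theorem mul_mem_rightPow (h : ∀ x y z : Z, mul (mul x y) z = mul x (mul z y - mul y z)) (n : ℕ) :
    ∀ i j : ℕ, i + j = n → ∀ a ∈ rightPow mul i, ∀ b ∈ rightPow mul j,
      mul a b ∈ rightPow mul (n + 1) := by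
  induction n with
  | zero =>
    intro i j hij a _ b _
    exact Submodule.apply_mem_map₂ mul trivial trivial
  | succ n ih =>
    intro i j hij a ha b hb
    cases i with
    | zero =>
      obtain rfl : j = n + 1 := by omega
      exact Submodule.apply_mem_map₂ mul trivial hb
    | succ i =>
      have key : rightPow mul (i + 1) ≤ (rightPow mul (n + 1 + 1)).comap (mul.flip b) := by
        rw [rightPow, Submodule.map₂_le]
        intro x _ a' ha'
        rw [Submodule.mem_comap, LinearMap.flip_apply, h]
        exact Submodule.apply_mem_map₂ mul trivial
          (Submodule.sub_mem _ (ih j i (by omega) b hb a' ha') (ih i j (by omega) a' ha' b hb))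
      exact key ha

theorem algPowerSeries_le_rightPow
    (h : ∀ x y z : Z, mul (mul x y) z = mul x (mul z y - mul y z)) (n : ℕ) :
    algPowerSeries mul (n + 1) ≤ rightPow mul n := by
  induction n using Nat.strong_induction_on with
  | _ n ih =>
    cases n with
    | zero => exact le_top
    | succ n =>
      rw [algPowerSeries]
      refine iSup_le fun i => Submodule.span_le.2 ?_
      rintro z ⟨x, hx, y, hy, rfl⟩
      have hi := i.2
      have e : n + 1 - (i : ℕ) = (n - i) + 1 := by omega
      rw [e] at hy
      exact mul_mem_rightPow mul h n i (n - i) (by omega) x (ih i (by omega) hx) y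
        (ih (n - i) (by omega) hy)

/-- Every product of eight elements, nested to the right, vanishes. -/
theorem nested_eight (h : ∀ x y z : Z, mul (mul x y) z = mul x (mul z y - mul y z))
    (p q x y z r s t : Z) :
    mul p (mul q (mul x (mul y (mul z (mul r (mul s t)))))) = 0 := by
  have anti : ∀ w a b, mul (mul w a) b = - mul (mul w b) a := by
    intro w a b
    rw [h, h, ← map_neg, neg_sub]
  have three : ∀ w a b c, mul (mul (mul w a) b) c = 0 := by
    intro w a b c
    have e1 : mul (mul (mul w a) b) c = mul (mul (mul w c) a) b := by
      rw [anti (mul w a) b c, anti w a c, map_neg, LinearMap.neg_apply, neg_neg]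
    have e2 : mul (mul (mul w a) b) c = - mul (mul (mul w c) a) b := by
      rw [h w a b, anti w _ c, ← h (mul w c) a b]
    rw [← e1] at e2
    rw [eq_neg_iff_add_eq_zero, ← two_smul ℂ] at e2
    exact (smul_eq_zero.mp e2).resolve_left two_ne_zero
  -- products involving a commutator
  have A : ∀ w a b c, mul (mul w (mul a b - mul b a)) c = 0 := by
    intro w a b c
    rw [← h]; exact three _ _ _ _
  have B : ∀ w c a b, mul (mul w c) (mul a b - mul b a) = 0 := by
    intro w c a b
    rw [← h]; exact three _ _ _ _
  have five : ∀ p q x y z a b,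
      mul p (mul q (mul x (mul y (mul z (mul a b - mul b a))))) = 0 := by
    intro p q x y z a b
    obtain ⟨u, hu⟩ : ∃ u, u = mul z (mul a b - mul b a) := ⟨_, rfl⟩
    have hu0 : ∀ w, mul u w = 0 := fun w => by rw [hu]; exact A _ _ _ _
    rw [← hu]
    have com : ∀ w, mul w u = mul w u - mul u w := fun w => by rw [hu0, sub_zero]
    have v1 : mul x (mul y u) = - mul (mul x y) u := by
      rw [h, hu0, zero_sub, map_neg, neg_neg]
    have v2 : mul (mul x (mul y u)) q = 0 := by
      rw [com y]; exact A _ _ _ _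
    have v3 : mul (mul p q) (mul x (mul y u)) = 0 := by
      rw [v1, map_neg, com (mul x y), B, neg_zero]
    rw [h, v2, zero_sub, map_neg, neg_eq_zero] at v3
    exact v3
  have e : mul r (mul s t) = (mul r (mul s t) - mul (mul s t) r) + mul s (mul r t - mul t r) := by
    rw [← h]; abel
  rw [e]
  simp only [map_add, five, zero_add]
  rw [map_zero]

end

/-- Every finite-dimensional anti-Zinbiel algebra over ℂ is
nilpotent: Z^N = {0} for some N ≥ 1. -/
theorem antiZinbiel_nilpotent
    (Z : Type*) [AddCommGroup Z] [Module ℂ Z] [FiniteDimensional ℂ Z]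
    (mul : Z →ₗ[ℂ] Z →ₗ[ℂ] Z)
    (hZ : ∀ x y z : Z,
      mul x (mul y z) = -(mul (mul x y) z - mul x (mul z y))) :
    ∃ N : ℕ, 1 ≤ N ∧ algPowerSeries mul N = ⊥ := by
  have h : ∀ x y z : Z, mul (mul x y) z = mul x (mul z y - mul y z) := by
    intro x y z
    rw [map_sub, hZ x y z]
    abel
  refine ⟨8, by norm_num, ?_⟩
  rw [eq_bot_iff]
  refine (algPowerSeries_le_rightPow mul h 7).trans ?_
  change rightPow mul 7 ≤ leftAnn mul 0
  iterate 7 apply rightPow_le_leftAnn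
  intro v _
  simp only [leftAnn, Submodule.mem_iInf, Submodule.mem_comap, Submodule.mem_bot]
  intros
  exact nested_eight mul h _ _ _ _ _ _ _ _
end
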